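/- For every integer b ≥ 3, the Hirzebruch–Jung continued fraction [7, 2, 2, ..., 2, 3, 2, 2] (with b−3 twos between the 7 and the 3) equals 2(12b−13)/(4b−5). For b = 2, [8,2,2] = 2(12·2−13)/(4·2−5) = 22/3. -/

import Mathlib

/-- Hirzebruch–Jung continued fraction `[a₁,…,aₙ] = a₁ − 1/[a₂,…,aₙ]`, `[a] = a`. -/
def hjCF : List ℚ → ℚ
  | [] => 0
  | [a] => a
  | a :: b :: l => a - 1 / hjCF (b :: l)

theorem hjCF_cons_ne (a : ℚ) (l : List ℚ) (h : l ≠ []) : hjCF (a :: l) = a - 1 / hjCF l := by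
  cases l with
  | nil => exact absurd rfl h
  | cons b l => rw [hjCF]

theorem hjCF_tail (k : ℕ) :
    hjCF (List.replicate k (2 : ℚ) ++ [3, 2, 2]) = (4 * (k : ℚ) + 7) / (4 * (k : ℚ) + 3) := by
  induction k with
  | zero => norm_num [hjCF]
  | succ k ih =>
    rw [List.replicate_succ, List.cons_append, hjCF_cons_ne _ _ (by simp), ih]
    have h1 : (4 * (k : ℚ) + 7) ≠ 0 := by positivity
    have h2 : (4 * (k : ℚ) + 3) ≠ 0 := by positivity
    have h3 : (4 * ((k : ℚ) + 1) + 3) ≠ 0 := by positivity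
    push_cast
    rw [one_div_div, eq_div_iff h3, sub_mul, div_mul_eq_mul_div, sub_eq_iff_eq_add,
      ← sub_eq_iff_eq_add', eq_div_iff h1]
    ring

/-- For `b ≥ 3`, `[7,2,…,2,3,2,2]` (with `b−3` twos) equals `2(12b−13)/(4b−5)`;
for `b = 2`, `[8,2,2] = 22/3 = 2(12·2−13)/(4·2−5)`. -/
theorem hj_O11 :
    (∀ b : ℕ, 3 ≤ b →
      hjCF ((7 : ℚ) :: (List.replicate (b - 3) (2 : ℚ) ++ [3, 2, 2])) =
        2 * (12 * (b : ℚ) - 13) / (4 * (b : ℚ) - 5)) ∧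
    hjCF [8, 2, 2] = 2 * (12 * (2 : ℚ) - 13) / (4 * (2 : ℚ) - 5) := by
  refine ⟨fun b hb => ?_, by norm_num [hjCF]⟩
  obtain ⟨k, rfl⟩ := Nat.exists_eq_add_of_le hb
  rw [Nat.add_sub_cancel_left, hjCF_cons_ne _ _ (by simp), hjCF_tail, one_div_div]
  have h1 : (4 * (k : ℚ) + 7) ≠ 0 := by positivity
  have h2 : 4 * ((3 + k : ℕ) : ℚ) - 5 = 4 * (k : ℚ) + 7 := by push_cast; ring
  rw [h2, eq_div_iff h1, sub_mul, div_mul_cancel₀ _ h1]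
  push_cast
  ring
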